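/- For every field k and every integer n ≥ 2, the Koszul-type complex K^n of right gn-modules, 0 → K^n_n → K^n_{n−1} → ⋯ → K^n_1 → K^n_0 → 0, defined as follows, is exact at every position. K^n_0 is the augmentation ideal of gn (the span of all elements of positive degree). For t ≥ 0, K^n_{t+1} is the free right gn-module with basis the symbols S(A:B), where A ⊆ I_n is nonempty, B ⊆ A with |B| = t, and min A ∉ B. The differential d: K^n_1 → K^n_0 sends S(A:∅) to r_A; for t ≥ 1 and B = {b_1 < ⋯ < b_t} ⊆ A with a_1 = min A ∉ B, d(S(A:B)) = Σ_{i=1}^{t} (−1)^{i−1} S(A : B∖{b_i}) ⊗ ( r_{A∖B} − r_{(A∖a_1)∖(B∖b_i)} ), signs being fixed so that d ∘ d = 0. -/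

import Mathlib

/-!
STATEMENT 13: For every field `k` and every integer `n ≥ 2`, the Koszul-type complex `K^n`
of right `gn`-modules `0 → K^n_n → ⋯ → K^n_1 → K^n_0 → 0` is exact at every position.
Here `K^n_0` is the augmentation ideal of `gn`; for `t ≥ 0`, `K^n_{t+1}` is the free right
`gn`-module on the symbols `S(A:B)` with `A ⊆ I_n` nonempty, `B ⊆ A`, `min A ∉ B`,
`|B| = t`; the differential sends `S(A:∅)` to `r_A`, and, for `B = {b_1 < ⋯ < b_t}`,
`d(S(A:B)) = Σ_{i=1}^{t} (−1)^{i−1} S(A : B∖{b_i}) ⊗ (r_{A∖B} − r_{(A∖a_1)∖(B∖b_i)})`.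

Right `gn`-modules are formalized as left modules over `R = gnᵐᵒᵖ`; the free right module
on the symbols `S(A:B)` with `|B| = t` is `KIdx n t →₀ R`, and `K^n_{t+2} → K^n_{t+1}` for
all `t` (these modules and maps vanish for `t + 1 > n`, giving the finite complex above).
-/

noncomputable section

open Finset MulOpposite

/-- Index type for generators: nonempty subsets `A ⊆ I_n = {1,…,n}` (modeled as `Fin n`). -/
abbrev SubsetIdx (n : ℕ) := {A : Finset (Fin n) // A.Nonempty}

/-- The free associative unital `k`-algebra `F` on the generators `r_A`. -/
abbrev FreeA (k : Type) [Field k] (n : ℕ) := FreeAlgebra k (SubsetIdx n)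

/-- The generator `r_A`, with the convention `r_∅ = 0`. -/
def rGen (k : Type) [Field k] (n : ℕ) (A : Finset (Fin n)) : FreeA k n :=
  if h : A.Nonempty then FreeAlgebra.ι k (⟨A, h⟩ : SubsetIdx n) else 0

/-- The quadratic relation `h_{A;i,j} = r_A (r_{A∖i} - r_{A∖j})`. -/
def hRel (k : Type) [Field k] (n : ℕ) (A : Finset (Fin n)) (i j : Fin n) : FreeA k n :=
  rGen k n A * (rGen k n (A.erase i) - rGen k n (A.erase j))

/-- The relation identifying each `h_{A;i,j}` (for `i, j ∈ A`) with `0`. -/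
inductive GnRel (k : Type) [Field k] (n : ℕ) : FreeA k n → FreeA k n → Prop
  | rel (A : Finset (Fin n)) (i j : Fin n) (hi : i ∈ A) (hj : j ∈ A) :
      GnRel k n (hRel k n A i j) 0

/-- The algebra `gn = F/I`. -/
abbrev Gn (k : Type) [Field k] (n : ℕ) := RingQuot (GnRel k n)

/-- The quotient map `F → gn`. -/
def GnMk (k : Type) [Field k] (n : ℕ) : FreeA k n →ₐ[k] Gn k n :=
  RingQuot.mkAlgHom k (GnRel k n)

/-- The degree-`d` component of `F`: the `k`-span of the words of length `d`. -/
def FreeADeg (k : Type) [Field k] (n : ℕ) (d : ℕ) : Submodule k (FreeA k n) :=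
  Submodule.span k
    {x | ∃ l : List (SubsetIdx n), l.length = d ∧ x = (l.map (FreeAlgebra.ι k)).prod}

/-- The degree-`d` graded component of `gn` (image of that of `F`). -/
def GnDeg (k : Type) [Field k] (n : ℕ) (d : ℕ) : Submodule k (Gn k n) :=
  (FreeADeg k n d).map (GnMk k n).toLinearMap

/-- The opposite algebra `R = gnᵐᵒᵖ`; left `R`-modules are right `gn`-modules. -/
abbrev GnOp (k : Type) [Field k] (n : ℕ) := (Gn k n)ᵐᵒᵖ

/-- The degree-`d` graded component of `R = gnᵐᵒᵖ`. -/
def GnOpDeg (k : Type) [Field k] (n : ℕ) (d : ℕ) : Submodule k (GnOp k n) :=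
  (GnDeg k n d).map (opLinearEquiv k).toLinearMap

/-- The augmentation ideal of `gn`, spanned by the elements of positive degree
(equivalently, `Σ_C r_C·gn`), as a left ideal of `R = gnᵐᵒᵖ` (i.e. as a right ideal
of `gn`).  This is the module `K^n_0`. -/
def augIdealG (k : Type) [Field k] (n : ℕ) : Ideal (GnOp k n) :=
  Ideal.span {x : GnOp k n | ∃ d : ℕ, 1 ≤ d ∧ x ∈ GnOpDeg k n d}

/-- `A` with its minimal element removed (`∅` if `A = ∅`). -/
def eraseMin {n : ℕ} (A : Finset (Fin n)) : Finset (Fin n) :=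
  if h : A.Nonempty then A.erase (A.min' h) else ∅

theorem op_rGen_mem_augIdealG (k : Type) [Field k] (n : ℕ) (A : Finset (Fin n))
    (hA : A.Nonempty) : op (GnMk k n (rGen k n A)) ∈ augIdealG k n := by
  refine Ideal.subset_span ⟨1, le_refl 1, GnMk k n (rGen k n A), ⟨rGen k n A, ?_, rfl⟩, rfl⟩
  exact Submodule.subset_span ⟨[⟨A, hA⟩], rfl, by simp [rGen, hA]⟩

/-- Index of the basis symbols `S(A:B)` of `K^n_{t+1}`: pairs `(A, B)` with `A` nonempty,
`B ⊆ A`, `min A ∉ B` (equivalently `B ⊆ A ∖ {min A}`) and `|B| = t`. -/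
def KIdx (n t : ℕ) :=
  {p : Finset (Fin n) × Finset (Fin n) //
    p.1.Nonempty ∧ p.2 ⊆ eraseMin p.1 ∧ p.2.card = t}

/-- The free right `gn`-module `K^n_{t+1}` on the symbols `S(A:B)`, `|B| = t`. -/
abbrev KMod (k : Type) [Field k] (n t : ℕ) := KIdx n t →₀ GnOp k n

/-- The coefficient `r_{A∖B} − r_{(A∖a_1)∖(B∖b)}` of `S(A : B∖{b})` in `d(S(A:B))`. -/
def dCoeff (k : Type) [Field k] (n : ℕ) (p : Finset (Fin n) × Finset (Fin n)) (b : Fin n) :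
    GnOp k n :=
  op (GnMk k n (rGen k n (p.1 \ p.2)) - GnMk k n (rGen k n (eraseMin p.1 \ p.2.erase b)))

/-- The value of the differential on the basis symbol `S(A:B)` with `|B| = t + 1`:
`Σ_{i=1}^{t+1} (−1)^{i−1} S(A : B∖{b_i}) ⊗ (r_{A∖B} − r_{(A∖a_1)∖(B∖b_i)})`, the sign
exponent `i − 1` being the number of elements of `B` smaller than `b_i`. -/
def dTarget (k : Type) [Field k] (n t : ℕ) (p : KIdx n (t + 1)) : KMod k n t :=
  ∑ b ∈ p.1.2.attach,
    ((-1 : ℤ) ^ (p.1.2.filter (fun y => y < b.1)).card) •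
      Finsupp.single
        (⟨(p.1.1, p.1.2.erase b.1),
          p.2.1, (Finset.erase_subset _ _).trans p.2.2.1,
          by simp [Finset.card_erase_of_mem b.2, p.2.2.2]⟩ : KIdx n t)
        (dCoeff k n p.1 b.1)

/-- The differential `d : K^n_{t+2} → K^n_{t+1}`. -/
def dMap (k : Type) [Field k] (n t : ℕ) : KMod k n (t + 1) →ₗ[GnOp k n] KMod k n t :=
  Finsupp.lsum ℕ fun p => LinearMap.toSpanSingleton (GnOp k n) _ (dTarget k n t p)

/-- The differential `d : K^n_1 → K^n_0`, `S(A:∅) ↦ r_A`. -/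
def dZero (k : Type) [Field k] (n : ℕ) : KMod k n 0 →ₗ[GnOp k n] augIdealG k n :=
  Finsupp.lsum ℕ fun p => LinearMap.toSpanSingleton (GnOp k n) _
    ⟨op (GnMk k n (rGen k n p.1.1)), op_rGen_mem_augIdealG k n p.1.1 p.2.1⟩

/-! ### The simplicial differential on functions of finite sets -/

section Simplicial

variable {α M N : Type*} [LinearOrder α] [AddCommGroup M] [AddCommGroup N]

/-- The sign `(-1)^{#{y ∈ B | y < b}}`. -/
def koszulSign (b : α) (B : Finset α) : ℤ := (-1 : ℤ) ^ (B.filter (fun y => y < b)).card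

theorem koszulSign_mul_self (b : α) (B : Finset α) : koszulSign b B * koszulSign b B = 1 := by
  simp [koszulSign, ← mul_pow]

theorem koszulSign_insert_self (b : α) (B : Finset α) :
    koszulSign b (insert b B) = koszulSign b B := by
  simp [koszulSign, Finset.filter_insert]

theorem koszulSign_erase_self (b : α) (B : Finset α) :
    koszulSign b (B.erase b) = koszulSign b B := by
  by_cases hb : b ∈ B
  · rw [← koszulSign_insert_self, Finset.insert_erase hb]
  · rw [Finset.erase_eq_of_notMem hb]

theorem koszulSign_insert {b c : α} {B : Finset α} (hb : b ∉ B) :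
    koszulSign c (insert b B) = if b < c then -koszulSign c B else koszulSign c B := by
  unfold koszulSign
  rw [Finset.filter_insert]
  split_ifs with h
  · rw [Finset.card_insert_of_notMem (by simp [hb]), pow_succ]
    ring
  · rfl

theorem koszulSign_anticomm {b c : α} {B : Finset α} (hb : b ∉ B) (hc : c ∉ B) (hbc : b ≠ c) :
    koszulSign b B * koszulSign c (insert b B) = -(koszulSign c B * koszulSign b (insert c B)) := by
  rw [koszulSign_insert hb, koszulSign_insert hc]
  rcases lt_or_gt_of_ne hbc with h | h
  · rw [if_pos h, if_neg h.not_gt]; ring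
  · rw [if_neg h.not_gt, if_pos h]; ring

/-- The contraction with the element `c`, a contracting homotopy of `simplicialDel`. -/
def simplicialCone (c : α) (f : Finset α → M) (D : Finset α) : M :=
  if c ∈ D then koszulSign c D • f (D.erase c) else 0

theorem subset_and_card_of_simplicialCone_ne_zero {f : Finset α → M} {A : Finset α} {t : ℕ}
    (hf : ∀ D, f D ≠ 0 → D ⊆ A ∧ D.card = t) {c : α} (hc : c ∈ A) {B : Finset α}
    (h : simplicialCone c f B ≠ 0) : B ⊆ A ∧ B.card = t + 1 := by
  unfold simplicialCone at h
  split_ifs at h with hcB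
  · obtain ⟨h1, h2⟩ := hf _ fun h0 => h (by rw [h0, smul_zero])
    refine ⟨?_, by rw [← Finset.card_erase_add_one hcB, h2]⟩
    rw [← Finset.insert_erase hcB]
    exact Finset.insert_subset hc h1
  · exact absurd rfl h

variable [Fintype α]

/-- The differential `(∂f)(B) = ∑_{b ∉ B} ± f(B ∪ b)`. -/
def simplicialDel (f : Finset α → M) (B : Finset α) : M :=
  ∑ b ∈ Bᶜ, koszulSign b B • f (insert b B)

theorem simplicialDel_comp (φ : M →+ N) (f : Finset α → M) (B : Finset α) :
    simplicialDel (fun D => φ (f D)) B = φ (simplicialDel f B) := by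
  simp [simplicialDel]

theorem simplicialDel_sum {ι : Type*} (s : Finset ι) (f : ι → Finset α → M) (B : Finset α) :
    simplicialDel (fun D => ∑ i ∈ s, f i D) B = ∑ i ∈ s, simplicialDel (f i) B := by
  simp only [simplicialDel, Finset.smul_sum]
  exact Finset.sum_comm

theorem simplicialDel_sub (f g : Finset α → M) (B : Finset α) :
    simplicialDel (fun D => f D - g D) B = simplicialDel f B - simplicialDel g B := by
  simp [simplicialDel, smul_sub]

theorem simplicialDel_simplicialDel (f : Finset α → M) (B : Finset α) :
    simplicialDel (simplicialDel f) B = 0 := by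
  simp only [simplicialDel, Finset.smul_sum, smul_smul]
  rw [Finset.sum_sigma']
  refine Finset.sum_involution (fun p _ => ⟨p.2, p.1⟩) ?_ ?_ ?_ ?_
  · rintro ⟨b, c⟩ h
    simp only [Finset.mem_sigma, Finset.mem_compl, Finset.mem_insert, not_or] at h
    rw [koszulSign_anticomm h.1 h.2.2 (Ne.symm h.2.1), Finset.insert_comm c b, neg_smul,
      neg_add_cancel]
  · rintro ⟨b, c⟩ h _ h'
    simp only [Finset.mem_sigma, Finset.mem_compl, Finset.mem_insert, not_or] at h
    simp only [Sigma.mk.injEq, heq_eq_eq] at h'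
    exact h.2.1 h'.1
  · rintro ⟨b, c⟩ h
    simp only [Finset.mem_sigma, Finset.mem_compl, Finset.mem_insert, not_or] at h ⊢
    exact ⟨h.2.2, Ne.symm h.2.1, h.1⟩
  · rintro ⟨b, c⟩ h
    rfl

theorem simplicialDel_cone_add (c : α) (f : Finset α → M) (B : Finset α) :
    simplicialDel (simplicialCone c f) B + simplicialCone c (simplicialDel f) B = f B := by
  by_cases hc : c ∈ B
  · have hcB : c ∉ B.erase c := Finset.notMem_erase c B
    have hcompl : (B.erase c)ᶜ = insert c Bᶜ := by
      ext x; by_cases hx : x = c <;> simp [hx]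
    have h1 : simplicialCone c (simplicialDel f) B =
        ∑ b ∈ Bᶜ, (koszulSign c (B.erase c) * koszulSign b (B.erase c)) •
          f (insert b (B.erase c)) + f B := by
      rw [simplicialCone, if_pos hc, simplicialDel, hcompl,
        Finset.sum_insert (by simpa using hc), smul_add, smul_smul, Finset.insert_erase hc,
        koszulSign_erase_self, koszulSign_mul_self, one_smul, add_comm, Finset.smul_sum]
      simp only [smul_smul]
    rw [h1, ← add_assoc, add_eq_right, simplicialDel, ← Finset.sum_add_distrib]
    refine Finset.sum_eq_zero fun b hb => ?_
    have hbB : b ∉ B := by simpa using hb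
    have hbc : b ≠ c := fun h => hbB (h ▸ hc)
    have hbB' : b ∉ B.erase c := fun h => hbB (Finset.mem_of_mem_erase h)
    have e1 : (insert b B).erase c = insert b (B.erase c) :=
      Finset.erase_insert_of_ne hbc
    have e2 : koszulSign c (insert b B) = koszulSign c (insert b (B.erase c)) := by
      rw [← koszulSign_erase_self, e1]
    have e3 : koszulSign b B = koszulSign b (insert c (B.erase c)) := by
      rw [Finset.insert_erase hc]
    rw [simplicialCone, if_pos (by simp [hc]), smul_smul, e1, ← add_smul, e2]
    have h2 := koszulSign_anticomm hbB' hcB hbc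
    have h3 := koszulSign_insert (c := c) hbB'
    have h4 := koszulSign_insert (c := b) hcB
    rw [e3, h3, h4]
    rcases lt_or_gt_of_ne hbc with h | h
    · rw [if_pos h, if_neg h.not_gt]
      convert zero_smul ℤ _ using 2; ring
    · rw [if_neg h.not_gt, if_pos h]
      convert zero_smul ℤ _ using 2; ring
  · rw [simplicialCone, if_neg hc, add_zero, simplicialDel, Finset.sum_eq_single c]
    · rw [simplicialCone, if_pos (by simp), smul_smul, koszulSign_insert_self, koszulSign_mul_self,
        one_smul, Finset.erase_insert hc]
    · intro b _ hb
      rw [simplicialCone, if_neg (by simp [hc, Ne.symm hb]), smul_zero]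
    · intro h
      exact absurd (by simpa using hc) h

theorem exists_of_simplicialDel_ne_zero {f : Finset α → M} {B : Finset α}
    (h : simplicialDel f B ≠ 0) : ∃ b, b ∉ B ∧ f (insert b B) ≠ 0 := by
  obtain ⟨b, hb, h'⟩ := Finset.exists_ne_zero_of_sum_ne_zero h
  exact ⟨b, by simpa using hb, fun h0 => h' (by rw [h0, smul_zero])⟩

theorem subset_and_card_of_simplicialDel_ne_zero {f : Finset α → M} {A : Finset α} {t : ℕ}
    (hf : ∀ D, f D ≠ 0 → D ⊆ A ∧ D.card = t + 1) {B : Finset α} (h : simplicialDel f B ≠ 0) :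
    B ⊆ A ∧ B.card = t := by
  obtain ⟨b, hb, h'⟩ := exists_of_simplicialDel_ne_zero h
  obtain ⟨h1, h2⟩ := hf _ h'
  rw [Finset.card_insert_of_notMem hb] at h2
  exact ⟨(Finset.subset_insert _ _).trans h1, by omega⟩

end Simplicial

/-! ### The ideals generated by differences of generators of equal size -/

section DiffIdeal

variable {α R : Type*} [Ring R]

/-- The left ideal generated by the differences `ρ C - ρ C'` with `C, C' ⊆ X` of cardinality
`m`. -/
def diffIdeal (ρ : Finset α → R) (m : ℕ) (X : Finset α) : Submodule R R :=
  Submodule.span R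
    {x | ∃ C C', C ⊆ X ∧ C' ⊆ X ∧ C.card = m ∧ C'.card = m ∧ x = ρ C - ρ C'}

variable {ρ : Finset α → R} {m : ℕ} {X Y : Finset α}

theorem sub_mem_diffIdeal {C C' : Finset α} (hC : C ⊆ X) (hC' : C' ⊆ X) (h : C.card = m)
    (h' : C'.card = m) : ρ C - ρ C' ∈ diffIdeal ρ m X :=
  Submodule.subset_span ⟨C, C', hC, hC', h, h', rfl⟩

theorem diffIdeal_mono (h : X ⊆ Y) : diffIdeal ρ m X ≤ diffIdeal ρ m Y := by
  refine Submodule.span_mono ?_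
  rintro x ⟨C, C', hC, hC', h1, h2, rfl⟩
  exact ⟨C, C', hC.trans h, hC'.trans h, h1, h2, rfl⟩

theorem diffIdeal_zero : diffIdeal ρ 0 X = ⊥ := by
  refine (Submodule.span_eq_bot).2 ?_
  rintro x ⟨C, C', -, -, h1, h2, rfl⟩
  rw [Finset.card_eq_zero] at h1 h2
  rw [h1, h2, sub_self]

theorem sum_mul_mem_diffIdeal {ι : Type*} (s : Finset ι) (u : ι → R) (C : ι → Finset α)
    (hC : ∀ i ∈ s, u i ≠ 0 → C i ⊆ X ∧ (C i).card = m) (hu : ∑ i ∈ s, u i = 0) :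
    ∑ i ∈ s, u i * ρ (C i) ∈ diffIdeal ρ m X := by
  by_cases! h : ∃ i ∈ s, u i ≠ 0
  · obtain ⟨i₀, hi₀, h₀⟩ := h
    have : ∑ i ∈ s, u i * ρ (C i) = ∑ i ∈ s, u i * (ρ (C i) - ρ (C i₀)) := by
      simp [mul_sub, ← Finset.sum_mul, hu]
    rw [this]
    refine Submodule.sum_mem _ fun i hi => ?_
    by_cases hui : u i = 0
    · simp [hui]
    · exact Submodule.smul_mem _ (u i) (sub_mem_diffIdeal (hC i hi hui).1 (hC i₀ hi₀ h₀).1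
        (hC i hi hui).2 (hC i₀ hi₀ h₀).2)
  · rw [Finset.sum_eq_zero fun i hi => by rw [h i hi, zero_mul]]
    exact Submodule.zero_mem _

theorem exists_sum_mul_of_mem_diffIdeal [DecidableEq α] [Fintype α] {x : R}
    (hx : x ∈ diffIdeal ρ m X) :
    ∃ u : Finset α → R, (∀ C, u C ≠ 0 → C ⊆ X ∧ C.card = m) ∧ ∑ C, u C = 0 ∧
      x = ∑ C, u C * ρ C := by
  induction hx using Submodule.span_induction with
  | mem x h =>
    obtain ⟨C, C', hC, hC', h1, h2, rfl⟩ := h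
    refine ⟨Pi.single C 1 - Pi.single C' 1, fun D hD => ?_, ?_, ?_⟩
    · by_cases e : D = C
      · exact e ▸ ⟨hC, h1⟩
      by_cases e' : D = C'
      · exact e' ▸ ⟨hC', h2⟩
      simp [e, e'] at hD
    · simp
    · simp [sub_mul, Finset.sum_sub_distrib, Pi.single_apply]
  | zero => exact ⟨0, by simp, by simp, by simp⟩
  | add x y _ _ hx hy =>
    obtain ⟨u, hu, hu', rfl⟩ := hx
    obtain ⟨v, hv, hv', rfl⟩ := hy
    refine ⟨u + v, fun C hC => ?_, ?_, ?_⟩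
    · by_cases e : u C = 0
      · exact hv C fun e' => hC (by simp [e, e'])
      · exact hu C e
    · simp [Finset.sum_add_distrib, hu', hv']
    · simp [add_mul, Finset.sum_add_distrib]
  | smul a x _ hx =>
    obtain ⟨u, hu, hu', rfl⟩ := hx
    refine ⟨a • u, fun C hC => hu C fun e => hC (by simp [e]), ?_, ?_⟩
    · simp [← Finset.mul_sum, hu']
    · simp [Finset.mul_sum, mul_assoc]

theorem diffIdeal_le_iSup [DecidableEq α] :
    diffIdeal ρ m X ≤ ⨆ C ∈ X.powersetCard (m + 1), diffIdeal ρ m C := by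
  refine Submodule.span_le.2 ?_
  rintro x ⟨C, C', hC, hC', h1, h2, rfl⟩
  induction hk : (C \ C').card generalizing C with
  | zero =>
    have : C ⊆ C' := by simpa using hk
    have : C = C' := Finset.eq_of_subset_of_card_le this (by omega)
    simp [this]
  | succ k ih =>
    obtain ⟨x, hx⟩ := Finset.card_pos.1 (by omega : 0 < (C \ C').card)
    have hk' : (C' \ C).card = k + 1 := by
      rw [← hk]; exact Finset.card_sdiff_comm (by omega)
    obtain ⟨y, hy⟩ := Finset.card_pos.1 (by omega : 0 < (C' \ C).card)
    rw [Finset.mem_sdiff] at hx hy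
    have hyx : y ∉ C.erase x := fun h => hy.2 (Finset.mem_of_mem_erase h)
    have hpos : 0 < C.card := Finset.card_pos.2 ⟨x, hx.1⟩
    have hcard : (insert y (C.erase x)).card = m := by
      rw [Finset.card_insert_of_notMem hyx, Finset.card_erase_of_mem hx.1]
      omega
    have hsub : insert y (C.erase x) ⊆ X :=
      Finset.insert_subset (hC' hy.1) ((Finset.erase_subset _ _).trans hC)
    have hdiff : insert y (C.erase x) \ C' = (C \ C').erase x := by
      rw [Finset.insert_sdiff_of_mem _ hy.1, Finset.erase_sdiff_comm]
    have h3 := ih (insert y (C.erase x)) hsub hcard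
      (by rw [hdiff, Finset.card_erase_of_mem (by simp [hx]), hk]; rfl)
    have h4 : ρ C - ρ (insert y (C.erase x)) ∈
        (⨆ C ∈ X.powersetCard (m + 1), diffIdeal ρ m C) := by
      have hmem : insert y C ∈ X.powersetCard (m + 1) := by
        rw [Finset.mem_powersetCard, Finset.card_insert_of_notMem hy.2, h1]
        exact ⟨Finset.insert_subset (hC' hy.1) hC, rfl⟩
      refine Submodule.mem_iSup_of_mem (insert y C) (Submodule.mem_iSup_of_mem hmem ?_)
      exact sub_mem_diffIdeal (Finset.subset_insert _ _)
        (Finset.insert_subset_insert _ (Finset.erase_subset _ _)) h1 hcard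
    have h5 := Submodule.add_mem _ h4 h3
    rwa [sub_add_sub_cancel] at h5

theorem exists_sum_of_mem_diffIdeal [DecidableEq α] [Fintype α] {x : R}
    (hx : x ∈ diffIdeal ρ m X) :
    ∃ q : Finset α → R, (∀ C, q C ≠ 0 → C ⊆ X ∧ C.card = m + 1) ∧
      (∀ C, q C ∈ diffIdeal ρ m C) ∧ x = ∑ C, q C := by
  obtain ⟨q, hq⟩ := (Submodule.mem_iSup_finset_iff_exists_sum _ _).1 (diffIdeal_le_iSup hx)
  refine ⟨fun C => if C ∈ X.powersetCard (m + 1) then q C else 0, fun C hC => ?_, fun C => ?_, ?_⟩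
  · have : C ∈ X.powersetCard (m + 1) := by
      by_contra hcon
      simp only [if_neg hcon, ne_eq, not_true_eq_false] at hC
    simpa [Finset.mem_powersetCard] using this
  · dsimp only
    split_ifs
    · exact (q C).2
    · exact Submodule.zero_mem _
  · rw [← hq, Finset.sum_ite_mem, Finset.univ_inter]

/-- A family `ρ` such that the left multiples of the `ρ C` are independent and the left
annihilator of `ρ C` is generated by the differences `ρ (C \ i) - ρ (C \ j)`. -/
structure IsGnFamily [Fintype α] (ρ : Finset α → R) : Prop where
  mul_eq_zero : ∀ (C : Finset α), C.Nonempty → ∀ x ∈ diffIdeal ρ (C.card - 1) C, x * ρ C = 0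
  mem_of_sum_eq_zero : ∀ u : Finset α → R, ∑ C, u C * ρ C = 0 →
    ∀ C, C.Nonempty → u C ∈ diffIdeal ρ (C.card - 1) C

/-- Exactness, in positions of cardinality at least `m + 2`, of the complex formed by the ideals
`diffIdeal ρ m X` over the subsets `X = A \ D` of `A`. -/
def DiffIdealExact [LinearOrder α] [Fintype α] (ρ : Finset α → R) (m : ℕ) :
    Prop :=
  ∀ (A : Finset α) (t : ℕ), t + m + 2 ≤ A.card → ∀ f : Finset α → R,
    (∀ D, f D ≠ 0 → D ⊆ A ∧ D.card = t) → (∀ D, f D ∈ diffIdeal ρ m (A \ D)) →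
    (∀ D, simplicialDel f D = 0) →
    ∃ g : Finset α → R, (∀ D, g D ≠ 0 → D ⊆ A ∧ D.card = t + 1) ∧
      (∀ D, g D ∈ diffIdeal ρ m (A \ D)) ∧ ∀ D, simplicialDel g D = f D

variable [LinearOrder α] [Fintype α]

theorem IsGnFamily.exists_cocycle_coeffs (hρ : IsGnFamily ρ) (ih : DiffIdealExact ρ m)
    {A : Finset α} {t : ℕ} (hA : t + m + 2 ≤ A.card) {f : Finset α → R}
    (hf : ∀ D, f D ≠ 0 → D ⊆ A ∧ D.card = t) (hfm : ∀ D, f D ∈ diffIdeal ρ (m + 1) (A \ D))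
    (hdf : ∀ D, simplicialDel f D = 0) :
    ∃ v : Finset α → Finset α → R,
      (∀ C D, v C D ≠ 0 → (C ⊆ A ∧ C.card = m + 1) ∧ D ⊆ A \ C ∧ D.card = t + 1) ∧
      (∀ D, simplicialDel (fun D => ∑ C, v C D) D = 0) ∧
      ∀ D, f D = ∑ C, simplicialDel (v C) D * ρ C := by
  have hrep : ∀ D, ∃ u : Finset α → R,
      (∀ C, u C ≠ 0 → (C ⊆ A ∧ C.card = m + 1) ∧ D ⊆ A \ C ∧ D.card = t) ∧ ∑ C, u C = 0 ∧
      f D = ∑ C, u C * ρ C := by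
    intro D
    by_cases hD : f D = 0
    · exact ⟨0, by simp, by simp, by simp [hD]⟩
    · obtain ⟨u, h1, h2, h3⟩ := exists_sum_mul_of_mem_diffIdeal (hfm D)
      refine ⟨u, fun C hC => ?_, h2, h3⟩
      obtain ⟨h4, h5⟩ := h1 C hC
      obtain ⟨h6, h7⟩ := hf D hD
      rw [Finset.subset_sdiff] at h4 ⊢
      exact ⟨⟨h4.1, h5⟩, ⟨h6, h4.2.symm⟩, h7⟩
  choose u hu hu0 hfu using hrep
  have hchoice : ∀ C : Finset α, ∃ c, C ⊆ A → C.card = m + 1 → c ∈ A \ C := by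
    intro C
    have hne : A.Nonempty := Finset.card_pos.1 (by omega)
    by_cases h : C ⊆ A ∧ C.card = m + 1
    · have : 0 < (A \ C).card := by rw [Finset.card_sdiff_of_subset h.1]; omega
      obtain ⟨c, hc⟩ := Finset.card_pos.1 this
      exact ⟨c, fun _ _ => hc⟩
    · exact ⟨hne.choose, fun h1 h2 => absurd ⟨h1, h2⟩ h⟩
  choose c hc using hchoice
  have hdu : ∀ C B, simplicialDel (fun D => u D C) B ∈ diffIdeal ρ m C := by
    intro C B
    by_cases h0 : simplicialDel (fun D => u D C) B = 0
    · rw [h0]; exact Submodule.zero_mem _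
    · obtain ⟨b, -, hb⟩ := exists_of_simplicialDel_ne_zero h0
      have hcard := (hu _ _ hb).1.2
      have h := hρ.mem_of_sum_eq_zero (fun C => simplicialDel (fun D => u D C) B) ?_ C
        (Finset.card_pos.1 (by omega))
      · rwa [hcard, Nat.add_sub_cancel] at h
      · rw [← hdf B]
        have : f = fun D => ∑ C, (AddMonoidHom.mulRight (ρ C)) (u D C) := by
          funext D; rw [hfu D]; rfl
        rw [this, simplicialDel_sum]
        simp only [simplicialDel_comp]
        rfl
  set w : Finset α → Finset α → R := fun C => simplicialCone (c C) (fun D => u D C) with hw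
  have hws : ∀ C D, w C D ≠ 0 → (C ⊆ A ∧ C.card = m + 1) ∧ D ⊆ A \ C ∧ D.card = t + 1 := by
    intro C D h
    have h1 : C ⊆ A ∧ C.card = m + 1 := by
      by_contra hcon
      have h0 : ∀ D, u D C = 0 := fun D => by
        by_contra h'
        exact hcon (hu D C h').1
      exact h (by simp [hw, simplicialCone, h0])
    exact ⟨h1, subset_and_card_of_simplicialCone_ne_zero (fun D hD => (hu D C hD).2)
      (hc C h1.1 h1.2) h⟩
  set r : Finset α → Finset α → R :=
    fun C => simplicialCone (c C) (simplicialDel fun D => u D C) with hr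
  have hdw : ∀ C D, simplicialDel (w C) D = u D C - r C D := by
    intro C D
    rw [eq_sub_iff_add_eq]
    exact simplicialDel_cone_add (c C) (fun D => u D C) D
  have hrm : ∀ C D, r C D ∈ diffIdeal ρ m C := by
    intro C D
    simp only [hr, simplicialCone]
    split_ifs
    · exact zsmul_mem (hdu C _) _
    · exact Submodule.zero_mem _
  have hrs : ∀ C D, r C D ≠ 0 → (C ⊆ A ∧ C.card = m + 1) ∧ D ⊆ A \ C ∧ D.card = t := by
    intro C D h
    by_cases h0 : u D C = 0
    · have h1 : simplicialDel (w C) D ≠ 0 := by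
        rw [hdw, h0, zero_sub, neg_ne_zero]; exact h
      obtain ⟨b, -, hb⟩ := exists_of_simplicialDel_ne_zero h1
      exact ⟨(hws C _ hb).1,
        subset_and_card_of_simplicialDel_ne_zero (fun D hD => (hws C D hD).2) h1⟩
    · exact hu D C h0
  have hrρ : ∀ C D, r C D * ρ C = 0 := by
    intro C D
    by_cases h0 : r C D = 0
    · rw [h0, zero_mul]
    · have h1 := (hrs C D h0).1.2
      refine hρ.mul_eq_zero C (Finset.card_pos.1 (by omega)) _ ?_
      rw [h1]
      exact hrm C D
  set p : Finset α → R := simplicialDel fun D => ∑ C, w C D with hp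
  have hpr : ∀ D, p D = -∑ C, r C D := by
    intro D
    rw [hp, simplicialDel_sum]
    simp only [hdw, Finset.sum_sub_distrib, hu0, zero_sub]
  have hps : ∀ D, p D ≠ 0 → D ⊆ A ∧ D.card = t := by
    intro D h
    rw [hpr, neg_ne_zero] at h
    obtain ⟨C, -, hC⟩ := Finset.exists_ne_zero_of_sum_ne_zero h
    obtain ⟨-, h1, h2⟩ := hrs C D hC
    exact ⟨h1.trans Finset.sdiff_subset, h2⟩
  have hpm : ∀ D, p D ∈ diffIdeal ρ m (A \ D) := by
    intro D
    rw [hpr]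
    refine Submodule.neg_mem _ (Submodule.sum_mem _ fun C _ => ?_)
    by_cases h0 : r C D = 0
    · rw [h0]; exact Submodule.zero_mem _
    · obtain ⟨h1, h2, -⟩ := hrs C D h0
      refine diffIdeal_mono ?_ (hrm C D)
      rw [Finset.subset_sdiff] at h2 ⊢
      exact ⟨h1.1, h2.2.symm⟩
  obtain ⟨q, hqs, hqm, hqd⟩ := ih A t hA p hps hpm fun D => simplicialDel_simplicialDel _ D
  have hsplit : ∀ D, ∃ q' : Finset α → R,
      (∀ C, q' C ≠ 0 → (C ⊆ A ∧ C.card = m + 1) ∧ D ⊆ A \ C ∧ D.card = t + 1) ∧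
      (∀ C, q' C ∈ diffIdeal ρ m C) ∧ q D = ∑ C, q' C := by
    intro D
    by_cases hD : q D = 0
    · exact ⟨0, by simp, by simp, by simp [hD]⟩
    · obtain ⟨h6, h7⟩ := hqs D hD
      obtain ⟨q', h1, h2, h3⟩ := exists_sum_of_mem_diffIdeal (hqm D)
      refine ⟨q', fun C hC => ?_, h2, h3⟩
      obtain ⟨h4, h5⟩ := h1 C hC
      rw [Finset.subset_sdiff] at h4 ⊢
      exact ⟨⟨h4.1, h5⟩, ⟨h6, h4.2.symm⟩, h7⟩
  choose q' hq's hq'm hq' using hsplit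
  refine ⟨fun C D => w C D - q' D C, fun C D h => ?_, fun D => ?_, fun D => ?_⟩
  · by_cases h0 : w C D = 0
    · exact hq's D C fun h1 => h (by simp only [h0, h1, sub_zero])
    · exact hws C D h0
  · simp only [Finset.sum_sub_distrib, ← hq']
    rw [simplicialDel_sub, hqd, sub_eq_zero]
  · have hq'ρ : ∀ C, simplicialDel (fun D => q' D C) D * ρ C = 0 := by
      intro C
      by_cases h0 : simplicialDel (fun D => q' D C) D = 0
      · rw [h0, zero_mul]
      · obtain ⟨b, -, hb⟩ := exists_of_simplicialDel_ne_zero h0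
        have h1 := (hq's _ C hb).1.2
        refine hρ.mul_eq_zero C (Finset.card_pos.1 (by omega)) _ ?_
        rw [h1]
        exact Submodule.sum_mem _ fun b _ => zsmul_mem (hq'm _ C) _
    rw [hfu]
    refine Finset.sum_congr rfl fun C _ => ?_
    rw [simplicialDel_sub, sub_mul, hq'ρ, hdw, sub_mul, hrρ, sub_zero, sub_zero]

theorem IsGnFamily.diffIdealExact (hρ : IsGnFamily ρ) (m : ℕ) : DiffIdealExact ρ m := by
  induction m with
  | zero =>
    intro A t _ f _ hfm _
    have hf0 : ∀ D, f D = 0 := fun D => by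
      have := hfm D
      rwa [diffIdeal_zero, Submodule.mem_bot] at this
    exact ⟨0, by simp, by simp, fun D => by simp [hf0, simplicialDel]⟩
  | succ m ih =>
    intro A t hA f hf hfm hdf
    obtain ⟨v, hv, hdv, hfv⟩ :=
      hρ.exists_cocycle_coeffs ih (by omega : t + m + 2 ≤ A.card) hf hfm hdf
    obtain ⟨a, ha⟩ : A.Nonempty := Finset.card_pos.1 (by omega)
    set s : Finset α → R := fun D => ∑ C, v C D with hs
    have hss : ∀ D, s D ≠ 0 → D ⊆ A ∧ D.card = t + 1 := by
      intro D h
      obtain ⟨C, -, hC⟩ := Finset.exists_ne_zero_of_sum_ne_zero h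
      obtain ⟨-, h1, h2⟩ := hv C D hC
      exact ⟨h1.trans Finset.sdiff_subset, h2⟩
    set e : Finset α → R := simplicialCone a s with he
    have hes : ∀ D, e D ≠ 0 → D ⊆ A ∧ D.card = t + 2 := fun D h =>
      subset_and_card_of_simplicialCone_ne_zero hss ha h
    have hde : ∀ D, simplicialDel e D = s D := by
      intro D
      have h1 := simplicialDel_cone_add a s D
      have h2 : simplicialCone a (simplicialDel s) D = 0 := by
        simp [simplicialCone, hdv]
      rwa [h2, add_zero] at h1
    have hC₀ : ∀ D, ∃ C : Finset α, e D ≠ 0 → C ⊆ A \ D ∧ C.card = m + 1 := by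
      intro D
      by_cases h : e D = 0
      · exact ⟨∅, fun h' => absurd h h'⟩
      · obtain ⟨h1, h2⟩ := hes D h
        have hcard : m + 1 ≤ (A \ D).card := by
          rw [Finset.card_sdiff_of_subset h1]; omega
        obtain ⟨C, hC⟩ := Finset.exists_subset_card_eq hcard
        exact ⟨C, fun _ => hC⟩
    choose C₀ hC₀ using hC₀
    set e' : Finset α → Finset α → R := fun C D => if C = C₀ D then e D else 0 with he'
    have he's : ∀ C D, e' C D ≠ 0 →
        (C ⊆ A ∧ C.card = m + 1) ∧ D ⊆ A \ C ∧ D.card = t + 2 := by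
      intro C D h
      simp only [he'] at h
      split_ifs at h with hC
      · obtain ⟨h1, h2⟩ := hC₀ D h
        obtain ⟨h3, h4⟩ := hes D h
        rw [← hC, Finset.subset_sdiff] at h1
        rw [← hC] at h2
        rw [Finset.subset_sdiff]
        exact ⟨⟨h1.1, h2⟩, ⟨h3, h1.2.symm⟩, h4⟩
      · exact absurd rfl h
    have hsume' : ∀ D, ∑ C, simplicialDel (e' C) D = s D := by
      intro D
      rw [← simplicialDel_sum, ← hde D]
      congr 1
      funext D
      simp [he']
    set x : Finset α → Finset α → R := fun C D => v C D - simplicialDel (e' C) D with hx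
    have hxs : ∀ C D, x C D ≠ 0 → (C ⊆ A ∧ C.card = m + 1) ∧ D ⊆ A \ C ∧ D.card = t + 1 := by
      intro C D h
      by_cases h0 : v C D = 0
      · have h1 : simplicialDel (e' C) D ≠ 0 := by
          simpa [hx, h0] using h
        obtain ⟨b, -, hb⟩ := exists_of_simplicialDel_ne_zero h1
        exact ⟨(he's C _ hb).1,
          subset_and_card_of_simplicialDel_ne_zero (fun D hD => (he's C D hD).2) h1⟩
      · exact hv C D h0
    refine ⟨fun D => ∑ C, x C D * ρ C, fun D h => ?_, fun D => ?_, fun D => ?_⟩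
    · obtain ⟨C, -, hC⟩ := Finset.exists_ne_zero_of_sum_ne_zero h
      obtain ⟨-, h1, h2⟩ := hxs C D fun h0 => hC (by rw [h0, zero_mul])
      exact ⟨h1.trans Finset.sdiff_subset, h2⟩
    · refine sum_mul_mem_diffIdeal _ (fun C => x C D) (fun C => C) (fun C _ hC => ?_) ?_
      · obtain ⟨h1, h2, -⟩ := hxs C D hC
        rw [Finset.subset_sdiff] at h2 ⊢
        exact ⟨⟨h1.1, h2.2.symm⟩, h1.2⟩
      · simp only [hx, Finset.sum_sub_distrib, hsume']
        exact sub_self _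
    · rw [simplicialDel_sum, hfv]
      refine Finset.sum_congr rfl fun C _ => ?_
      have h1 := simplicialDel_comp (AddMonoidHom.mulRight (ρ C)) (x C) D
      refine h1.trans ?_
      simp only [hx, simplicialDel_sub, simplicialDel_simplicialDel, sub_zero]
      rfl

/-! ### The Koszul differential of a single set -/

/-- The differential `(dy)(B) = ∑_{b ∉ B} ± y(B ∪ b) (ρ(A \ (B ∪ b)) - ρ((A \ a) \ B))`. -/
def koszulDel (ρ : Finset α → R) (A : Finset α) (a : α) (y : Finset α → R) (B : Finset α) : R :=
  ∑ b ∈ Bᶜ, koszulSign b B • (y (insert b B) * (ρ (A \ insert b B) - ρ (A.erase a \ B)))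

theorem koszulDel_eq (A : Finset α) (a : α) (y : Finset α → R) (B : Finset α) :
    koszulDel ρ A a y B = simplicialDel (fun D => y D * ρ (A \ D)) B -
      simplicialDel y B * ρ (A.erase a \ B) := by
  simp only [koszulDel, simplicialDel, mul_sub, smul_sub, Finset.sum_sub_distrib, Finset.sum_mul,
    smul_mul_assoc]

theorem simplicialDel_mul_mem_diffIdeal {A : Finset α} {a : α} (ha : a ∈ A) {t : ℕ}
    (hA : A.card = t + m + 1) {x : Finset α → R}
    (hx : ∀ D, x D ≠ 0 → D ⊆ A.erase a ∧ D.card = t) {B : Finset α} (hdx : simplicialDel x B = 0) :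
    simplicialDel (fun D => x D * ρ (A.erase a \ D)) B ∈ diffIdeal ρ m (A.erase a \ B) := by
  have h : simplicialDel (fun D => x D * ρ (A.erase a \ D)) B =
      ∑ b ∈ Bᶜ, (koszulSign b B • x (insert b B)) * ρ (A.erase a \ insert b B) := by
    simp only [simplicialDel, smul_mul_assoc]
  rw [h]
  refine sum_mul_mem_diffIdeal Bᶜ (fun b => koszulSign b B • x (insert b B))
    (fun b => A.erase a \ insert b B) (fun b _ hb => ?_) hdx
  obtain ⟨h1, h2⟩ := hx (insert b B) fun h0 => hb (by simp only [h0, smul_zero])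
  refine ⟨Finset.sdiff_subset_sdiff subset_rfl (Finset.subset_insert _ _), ?_⟩
  rw [Finset.card_sdiff_of_subset h1, Finset.card_erase_of_mem ha]
  omega

theorem koszulDel_mem_diffIdeal {A : Finset α} {a : α} (ha : a ∈ A) {t : ℕ}
    (hA : A.card = t + m + 1) {y : Finset α → R}
    (hy : ∀ D, y D ≠ 0 → D ⊆ A.erase a ∧ D.card = t + 1) (B : Finset α) :
    koszulDel ρ A a y B ∈ diffIdeal ρ m (A \ B) := by
  refine Submodule.sum_mem _ fun b hb => zsmul_mem ?_ _
  by_cases h0 : y (insert b B) = 0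
  · rw [h0, zero_mul]; exact Submodule.zero_mem _
  · obtain ⟨h1, h2⟩ := hy _ h0
    have h3 : B ⊆ A.erase a := (Finset.subset_insert _ _).trans h1
    rw [Finset.mem_compl] at hb
    have h4 := h2
    rw [Finset.card_insert_of_notMem hb] at h4
    refine Submodule.smul_mem _ (y (insert b B)) (sub_mem_diffIdeal
      (Finset.sdiff_subset_sdiff subset_rfl (Finset.subset_insert _ _))
      (Finset.sdiff_subset_sdiff (Finset.erase_subset _ _) subset_rfl) ?_ ?_)
    · rw [Finset.card_sdiff_of_subset (h1.trans (Finset.erase_subset _ _))]; omega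
    · rw [Finset.card_sdiff_of_subset h3, Finset.card_erase_of_mem ha]; omega

theorem simplicialDel_koszulDel_mem_diffIdeal {A : Finset α} {a : α} (ha : a ∈ A) {t : ℕ}
    (hA : A.card = t + m + 1) {y : Finset α → R}
    (hy : ∀ D, y D ≠ 0 → D ⊆ A.erase a ∧ D.card = t + 1) (B : Finset α) :
    simplicialDel (koszulDel ρ A a y) B ∈ diffIdeal ρ m (A.erase a \ B) := by
  have h : koszulDel ρ A a y = fun D => simplicialDel (fun D => y D * ρ (A \ D)) D -
      simplicialDel y D * ρ (A.erase a \ D) := funext fun D => koszulDel_eq A a y D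
  rw [h, simplicialDel_sub]
  rw [simplicialDel_simplicialDel, zero_sub]
  exact Submodule.neg_mem _ (simplicialDel_mul_mem_diffIdeal ha hA
    (fun D hD => subset_and_card_of_simplicialDel_ne_zero hy hD) (simplicialDel_simplicialDel y B))

theorem IsGnFamily.koszulDel_eq_zero (hρ : IsGnFamily ρ) {A : Finset α} {a : α} (ha : a ∈ A)
    {t : ℕ} (hA : A.card = t + 1 + m + 1) {z : Finset α → R}
    (hz : ∀ D, z D ≠ 0 → D ⊆ A.erase a ∧ D.card = t + 1)
    (hzm : ∀ D, z D ∈ diffIdeal ρ m (A \ D))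
    (hdz : ∀ D, simplicialDel z D ∈ diffIdeal ρ m (A.erase a \ D)) (B : Finset α) :
    koszulDel ρ A a z B = 0 := by
  have h1 : ∀ D, z D * ρ (A \ D) = 0 := by
    intro D
    by_cases h0 : z D = 0
    · rw [h0, zero_mul]
    · obtain ⟨h1, h2⟩ := hz D h0
      have hcard : (A \ D).card = m + 1 := by
        rw [Finset.card_sdiff_of_subset (h1.trans (Finset.erase_subset _ _))]; omega
      refine hρ.mul_eq_zero _ (Finset.card_pos.1 (by omega)) _ ?_
      rw [hcard]
      exact hzm D
  have h2 : simplicialDel z B * ρ (A.erase a \ B) = 0 := by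
    by_cases h0 : simplicialDel z B = 0
    · rw [h0, zero_mul]
    · obtain ⟨h1, h2⟩ := subset_and_card_of_simplicialDel_ne_zero hz h0
      have hcard : (A.erase a \ B).card = m + 1 := by
        rw [Finset.card_sdiff_of_subset h1, Finset.card_erase_of_mem ha]; omega
      refine hρ.mul_eq_zero _ (Finset.card_pos.1 (by omega)) _ ?_
      rw [hcard]
      exact hdz B
  rw [koszulDel_eq, h2, sub_zero]
  simp [h1, simplicialDel]

theorem IsGnFamily.mem_of_sum_eq_zero_of_injOn (hρ : IsGnFamily ρ) {ι : Type*} {s : Finset ι}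
    {x : ι → R} {C : ι → Finset α} (hC : Set.InjOn C s) (h : ∑ i ∈ s, x i * ρ (C i) = 0) {i : ι}
    (hi : i ∈ s) (hne : (C i).Nonempty) : x i ∈ diffIdeal ρ ((C i).card - 1) (C i) := by
  have h1 := hρ.mem_of_sum_eq_zero (fun D => ∑ j ∈ s, if C j = D then x j else 0) ?_ (C i) hne
  · have h2 : ∑ j ∈ s, (if C j = C i then x j else 0) = x i := by
      rw [Finset.sum_eq_single i]
      · simp
      · intro j hj hji
        exact if_neg fun e => hji (hC hj hi e)
      · exact fun h => absurd hi h
    rwa [h2] at h1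
  · refine Eq.trans ?_ h
    simp only [Finset.sum_mul, ite_mul, zero_mul]
    rw [Finset.sum_comm]
    simp

theorem IsGnFamily.mem_diffIdeal_of_koszulDel_eq_zero_aux (hρ : IsGnFamily ρ) {A : Finset α}
    {a : α} (ha : a ∈ A) {t : ℕ} (hA : A.card = t + 1 + m + 1) {z : Finset α → R}
    (hz : ∀ D, z D ≠ 0 → D ⊆ A.erase a ∧ D.card = t + 1) {B : Finset α} (hB : B ⊆ A.erase a)
    (hBt : B.card = t) (hd : koszulDel ρ A a z B = 0) :
    simplicialDel z B ∈ diffIdeal ρ m (A.erase a \ B) ∧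
      ∀ b ∈ A.erase a \ B, z (insert b B) ∈ diffIdeal ρ m (A \ insert b B) := by
  have haB : a ∉ B := fun h => Finset.notMem_erase a A (hB h)
  have haA : a ∈ A \ B := Finset.mem_sdiff.2 ⟨ha, haB⟩
  set x : α → R := fun b => if b = a then -simplicialDel z B else koszulSign b B • z (insert b B)
    with hx
  have hAa : A \ insert a B = A.erase a \ B := by
    ext c; simp only [Finset.mem_sdiff, Finset.mem_insert, Finset.mem_erase]; tauto
  have hsum : ∑ b ∈ A \ B, x b * ρ (A \ insert b B) = 0 := by
    rw [← Finset.add_sum_erase _ _ haA, ← hd, koszulDel_eq, hAa, sub_eq_neg_add]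
    congr 1
    · simp [hx]
    · rw [simplicialDel]
      refine Finset.sum_subset_zero_on_sdiff (fun b hb => ?_) (fun b hb => ?_) (fun b hb => ?_)
      · simp only [Finset.mem_erase, Finset.mem_sdiff] at hb
        simpa using hb.2.2
      · simp only [Finset.mem_sdiff, Finset.mem_compl, Finset.mem_erase, not_and, not_not] at hb
        by_cases h0 : z (insert b B) = 0
        · simp [h0]
        · have h1 := (hz _ h0).1 (Finset.mem_insert_self b B)
          rw [Finset.mem_erase] at h1
          exact absurd (hb.2 h1.1 h1.2) hb.1
      · simp only [hx, if_neg (Finset.ne_of_mem_erase hb), smul_mul_assoc]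
  have hinj : Set.InjOn (fun b => A \ insert b B) (A \ B : Finset α) := by
    intro b hb c hc hbc
    simp only [Finset.mem_coe, Finset.mem_sdiff] at hb hc
    by_contra hne
    have h1 : b ∈ A \ insert c B := by simp [hb.1, hb.2, hne]
    have h2 : b ∉ A \ insert b B := by simp
    exact h2 ((congrArg (b ∈ ·) hbc).mpr h1)
  have hcard : ∀ b ∈ A \ B, (A \ insert b B).card = m + 1 := by
    intro b hb
    rw [Finset.mem_sdiff] at hb
    rw [Finset.card_sdiff_of_subset
      (Finset.insert_subset hb.1 (hB.trans (Finset.erase_subset _ _))),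
      Finset.card_insert_of_notMem hb.2]
    omega
  have hmem : ∀ b ∈ A \ B, x b ∈ diffIdeal ρ m (A \ insert b B) := by
    intro b hb
    have h1 := hρ.mem_of_sum_eq_zero_of_injOn hinj hsum hb
      (Finset.card_pos.1 (by rw [hcard b hb]; omega))
    rwa [hcard b hb] at h1
  refine ⟨?_, fun b hb => ?_⟩
  · have h1 := hmem a haA
    rw [hAa] at h1
    simpa [hx] using h1
  · have hb' : b ∈ A \ B := Finset.sdiff_subset_sdiff (Finset.erase_subset _ _) subset_rfl hb
    have hba : b ≠ a := by
      rintro rfl; simp at hb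
    have h1 := zsmul_mem (hmem b hb') (koszulSign b B)
    simpa only [hx, if_neg hba, smul_smul, koszulSign_mul_self, one_smul] using h1

theorem IsGnFamily.mem_diffIdeal_of_koszulDel_eq_zero (hρ : IsGnFamily ρ) {A : Finset α}
    {a : α} (ha : a ∈ A) {t : ℕ} (hA : A.card = t + 1 + m + 1) {z : Finset α → R}
    (hz : ∀ D, z D ≠ 0 → D ⊆ A.erase a ∧ D.card = t + 1)
    (hd : ∀ B, B ⊆ A.erase a → B.card = t → koszulDel ρ A a z B = 0) :
    (∀ D, z D ∈ diffIdeal ρ m (A \ D)) ∧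
      ∀ D, simplicialDel z D ∈ diffIdeal ρ m (A.erase a \ D) := by
  refine ⟨fun D => ?_, fun D => ?_⟩
  · by_cases h0 : z D = 0
    · rw [h0]; exact Submodule.zero_mem _
    · obtain ⟨h1, h2⟩ := hz D h0
      obtain ⟨b, hb⟩ := Finset.card_pos.1 (by omega : 0 < D.card)
      have h3 : D.erase b ⊆ A.erase a := (Finset.erase_subset _ _).trans h1
      have h4 : (D.erase b).card = t := by rw [Finset.card_erase_of_mem hb]; omega
      have h5 := (hρ.mem_diffIdeal_of_koszulDel_eq_zero_aux ha hA hz h3 h4 (hd _ h3 h4)).2 b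
        (by simpa using h1 hb)
      rwa [Finset.insert_erase hb] at h5
  · by_cases h0 : simplicialDel z D = 0
    · rw [h0]; exact Submodule.zero_mem _
    · obtain ⟨h1, h2⟩ := subset_and_card_of_simplicialDel_ne_zero hz h0
      exact (hρ.mem_diffIdeal_of_koszulDel_eq_zero_aux ha hA hz h1 h2 (hd _ h1 h2)).1

theorem IsGnFamily.exists_koszulDel_eq (hρ : IsGnFamily ρ) {A : Finset α} {a : α} (ha : a ∈ A)
    {t : ℕ} (hA : A.card = t + m + 1) {z : Finset α → R}
    (hz : ∀ D, z D ≠ 0 → D ⊆ A.erase a ∧ D.card = t)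
    (hzm : ∀ D, z D ∈ diffIdeal ρ m (A \ D))
    (hdz : ∀ D, simplicialDel z D ∈ diffIdeal ρ m (A.erase a \ D)) :
    ∃ y : Finset α → R, (∀ D, y D ≠ 0 → D ⊆ A.erase a ∧ D.card = t + 1) ∧
      ∀ B, koszulDel ρ A a y B = z B := by
  rcases m with - | m
  · have hz0 : ∀ D, z D = 0 := fun D => by
      have := hzm D
      rwa [diffIdeal_zero, Submodule.mem_bot] at this
    exact ⟨0, by simp, fun B => by simp [hz0, koszulDel]⟩
  set f : Finset α → R := simplicialDel (simplicialCone a z) with hf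
  have hz' : ∀ D, z D ≠ 0 → D ⊆ A ∧ D.card = t := fun D hD =>
    ⟨(hz D hD).1.trans (Finset.erase_subset _ _), (hz D hD).2⟩
  have hfz : ∀ D, a ∉ D → f D = z D := by
    intro D hD
    have h1 := simplicialDel_cone_add a z D
    rwa [simplicialCone, if_neg hD, add_zero] at h1
  have hza : ∀ D, a ∈ D → z D = 0 := by
    intro D hD
    by_contra h
    exact Finset.notMem_erase a A ((hz D h).1 hD)
  have hfm : ∀ D, f D ∈ diffIdeal ρ (m + 1) (A \ D) := by
    intro D
    by_cases hD : a ∈ D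
    · have h1 := simplicialDel_cone_add a z D
      rw [simplicialCone, if_pos hD, hza D hD] at h1
      rw [hf, eq_neg_of_add_eq_zero_left h1]
      have h2 : A.erase a \ D.erase a = A \ D := by
        ext c
        simp only [Finset.mem_sdiff, Finset.mem_erase]
        by_cases hc : c = a
        · simp [hc, hD]
        · simp [hc]
      exact Submodule.neg_mem _ (zsmul_mem (h2 ▸ hdz (D.erase a)) _)
    · rw [hfz D hD]; exact hzm D
  obtain ⟨v, hv, hdv, hfv⟩ := hρ.exists_cocycle_coeffs (hρ.diffIdealExact m)
    (by omega : t + m + 2 ≤ A.card)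
    (fun D hD => subset_and_card_of_simplicialDel_ne_zero
      (fun D hD => subset_and_card_of_simplicialCone_ne_zero hz' ha hD) hD) hfm
    (fun D => simplicialDel_simplicialDel _ D)
  set s : Finset α → R := fun D => ∑ C, v C D with hs
  have hss : ∀ D, s D ≠ 0 → D ⊆ A ∧ D.card = t + 1 := by
    intro D h
    obtain ⟨C, -, hC⟩ := Finset.exists_ne_zero_of_sum_ne_zero h
    obtain ⟨-, h1, h2⟩ := hv C D hC
    exact ⟨h1.trans Finset.sdiff_subset, h2⟩
  have hsv : ∀ D, ∑ C, v C D * ρ C = s D * ρ (A \ D) := by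
    intro D
    rw [hs, Finset.sum_mul]
    refine Finset.sum_congr rfl fun C _ => ?_
    by_cases h0 : v C D = 0
    · rw [h0, zero_mul, zero_mul]
    · obtain ⟨⟨h1, h2⟩, h3, h4⟩ := hv C D h0
      have h5 : C ⊆ A \ D := by
        rw [Finset.subset_sdiff] at h3 ⊢
        exact ⟨h1, h3.2.symm⟩
      have h6 : C = A \ D := by
        refine Finset.eq_of_subset_of_card_le h5 ?_
        rw [Finset.card_sdiff_of_subset (h3.trans Finset.sdiff_subset)]
        omega
      rw [← h6]
  have hfs : ∀ B, f B = simplicialDel (fun D => s D * ρ (A \ D)) B := by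
    intro B
    refine (hfv B).trans ?_
    simp only [← hsv]
    rw [simplicialDel_sum]
    exact Finset.sum_congr rfl fun C _ =>
      (simplicialDel_comp (AddMonoidHom.mulRight (ρ C)) (v C) B).symm
  refine ⟨fun D => if a ∈ D then 0 else s D, fun D hD => ?_, fun B => ?_⟩
  · simp only at hD
    split_ifs at hD with haD
    · exact absurd rfl hD
    · obtain ⟨h1, h2⟩ := hss D hD
      exact ⟨Finset.subset_erase.2 ⟨h1, haD⟩, h2⟩
  · by_cases haB : a ∈ B
    · rw [hza B haB]
      exact Finset.sum_eq_zero fun b _ => by simp [haB]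
    · have h1 : z B = koszulDel ρ A a s B := by
        rw [koszulDel_eq, hdv, zero_mul, sub_zero, ← hfs, hfz B haB]
      rw [h1]
      refine Finset.sum_congr rfl fun b _ => ?_
      by_cases hb : b = a
      · have h2 : A \ insert a B = A.erase a \ B := by
          ext c; simp only [Finset.mem_sdiff, Finset.mem_insert, Finset.mem_erase]; tauto
        rw [hb, h2, sub_self, mul_zero, mul_zero]
      · have h2 : a ∉ insert b B := by simp [haB, Ne.symm hb]
        simp only [if_neg h2]

end DiffIdeal

section KoszulDelBasic

variable {α R : Type*} [LinearOrder α] [Fintype α] [Ring R] {ρ : Finset α → R}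

theorem koszulDel_add (A : Finset α) (a : α) (y z : Finset α → R) (B : Finset α) :
    koszulDel ρ A a (fun D => y D + z D) B = koszulDel ρ A a y B + koszulDel ρ A a z B := by
  simp only [koszulDel, add_mul, smul_add, Finset.sum_add_distrib]

theorem koszulDel_eq_sum_mul (A : Finset α) (a : α) (y : Finset α → R) (B : Finset α) :
    koszulDel ρ A a y B =
      ∑ b ∈ Bᶜ, y (insert b B) * koszulSign b B • (ρ (A \ insert b B) - ρ (A.erase a \ B)) := by
  simp only [koszulDel, mul_smul_comm]

theorem koszulDel_eq_zero_of_forall {A : Finset α} {a : α} {y : Finset α → R} {B : Finset α}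
    (h : ∀ b ∉ B, y (insert b B) = 0) : koszulDel ρ A a y B = 0 :=
  Finset.sum_eq_zero fun b hb => by rw [h b (Finset.mem_compl.1 hb), zero_mul, smul_zero]

theorem simplicialDel_eq_zero_of_forall {y : Finset α → R} {B : Finset α}
    (h : ∀ b ∉ B, y (insert b B) = 0) : simplicialDel y B = 0 :=
  Finset.sum_eq_zero fun b hb => by rw [h b (Finset.mem_compl.1 hb), smul_zero]

end KoszulDelBasic

/-! ### Extending a family of modules by a cyclic vector -/

section CyclicModel

variable {k ι S : Type*} [Field k] [DecidableEq ι] [Ring S] [Algebra k S]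
  (φ : FreeAlgebra k ι →ₐ[k] S)
  {Q : ι → Type*} [∀ i, AddCommGroup (Q i)] [∀ i, Module k (Q i)] [∀ i, Module Sᵐᵒᵖ (Q i)]
  [∀ i, IsScalarTower k Sᵐᵒᵖ (Q i)] (e : ∀ i, Q i)

/-- The operator on `k ⊕ ∏ Q i` by which the generator `D` acts: it sends the cyclic vector of `k`
to `e D`. -/
def cyclicModelGen (D : ι) : (k × ∀ i, Q i) →ₗ[k] (k × ∀ i, Q i) where
  toFun x := (0, op (φ (FreeAlgebra.ι k D)) • x.2 + Pi.single D (x.1 • e D))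
  map_add' x y := by
    ext1
    · simp
    · simp only [Prod.snd_add, Prod.fst_add, smul_add, add_smul, Pi.single_add]
      abel
  map_smul' c x := by
    ext1
    · simp
    · simp only [Prod.smul_snd, Prod.smul_fst, smul_add, smul_assoc, RingHom.id_apply,
        Pi.single_smul]
      rw [smul_algebra_smul_comm]

/-- The right action of the free algebra on `k ⊕ ∏ Q i`. -/
def cyclicModelHom : FreeAlgebra k ι →ₐ[k] (Module.End k (k × ∀ i, Q i))ᵐᵒᵖ :=
  FreeAlgebra.lift k fun D => op (cyclicModelGen φ e D)

theorem cyclicModelHom_apply_zero (x : FreeAlgebra k ι) (v : ∀ i, Q i) :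
    (cyclicModelHom φ e x).unop (0, v) = (0, op (φ x) • v) := by
  induction x using FreeAlgebra.induction generalizing v with
  | grade0 r =>
    rw [AlgHom.commutes, AlgHom.commutes]
    ext1
    · simp [MulOpposite.algebraMap_apply]
    · rw [← MulOpposite.algebraMap_apply, algebraMap_smul]
      simp [MulOpposite.algebraMap_apply]
  | grade1 D => simp [cyclicModelHom, cyclicModelGen]
  | mul a b ha hb =>
    rw [map_mul, map_mul, unop_mul, Module.End.mul_apply, ha, hb, op_mul, mul_smul]
  | add a b ha hb =>
    rw [map_add, map_add, unop_add, LinearMap.add_apply, ha, hb, op_add, add_smul]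
    simp

theorem cyclicModelHom_ι_mul (D : ι) (y : FreeAlgebra k ι) (x : k × ∀ i, Q i) :
    (cyclicModelHom φ e (FreeAlgebra.ι k D * y)).unop x =
      (0, fun i => op (φ (FreeAlgebra.ι k D * y)) • x.2 i +
        Pi.single (M := Q) D (x.1 • op (φ y) • e D) i) := by
  have h2 : (cyclicModelHom φ e (FreeAlgebra.ι k D)).unop x =
      (0, op (φ (FreeAlgebra.ι k D)) • x.2 + Pi.single D (x.1 • e D)) := by
    rw [cyclicModelHom, FreeAlgebra.lift_ι_apply]
    rfl
  rw [map_mul, unop_mul, Module.End.mul_apply, h2, cyclicModelHom_apply_zero, map_mul, op_mul,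
    smul_add, ← Pi.single_smul, smul_algebra_smul_comm]
  ext1
  · rfl
  · funext i
    simp only [Pi.add_apply, Pi.smul_apply, mul_smul]

theorem cyclicModelHom_ι_mul_eq_zero {D : ι} {y : FreeAlgebra k ι}
    (h1 : op (φ y) • e D = 0) (h2 : φ (FreeAlgebra.ι k D * y) = 0) :
    cyclicModelHom φ e (FreeAlgebra.ι k D * y) = 0 := by
  refine unop_injective (LinearMap.ext fun x => ?_)
  rw [cyclicModelHom_ι_mul, h1, h2]
  ext1
  · rfl
  · funext i
    simp

/-- If the action of the free algebra on `k ⊕ ∏ Q i` factors through `S`, then a relation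
`∑ φ(r_i) u_i = 0` in `S` forces `u_i` to annihilate `e i`. -/
theorem smul_eq_zero_of_sum_mul_eq_zero [Fintype ι] (hφ : Function.Surjective φ)
    (ψ : S →ₐ[k] (Module.End k (k × ∀ i, Q i))ᵐᵒᵖ)
    (hψ : ∀ x, ψ (φ x) = cyclicModelHom φ e x) (u : ι → Sᵐᵒᵖ)
    (hu : ∑ i, u i * op (φ (FreeAlgebra.ι k i)) = 0) (C : ι) : u C • e C = 0 := by
  have h1 : ∀ D, (ψ (unop (u D * op (φ (FreeAlgebra.ι k D))))).unop (1, 0) =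
      (0, Pi.single D (u D • e D)) := by
    intro D
    obtain ⟨y, hy⟩ := hφ (unop (u D))
    rw [unop_mul, ← hy, unop_op, ← map_mul, hψ, cyclicModelHom_ι_mul, hy, op_unop]
    simp
  have h2 := congrArg (fun x => ((ψ (unop x)).unop (1, 0)).2 C) hu
  simp only [Finset.unop_sum, map_sum, LinearMap.sum_apply, Prod.snd_sum, Finset.sum_apply, h1,
    unop_zero, map_zero, LinearMap.zero_apply, Prod.snd_zero, Pi.zero_apply] at h2
  rwa [Finset.sum_pi_single, if_pos (Finset.mem_univ C)] at h2

end CyclicModel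

/-! ### The generators of `gn` -/

section Gn

variable (k : Type) [Field k] (n : ℕ)

/-- The class of `r_A` in `gnᵐᵒᵖ`. -/
def gnGen (A : Finset (Fin n)) : GnOp k n := op (GnMk k n (rGen k n A))

variable {k n} in
theorem gnGen_empty : gnGen k n ∅ = 0 := by
  simp [gnGen, rGen]

theorem GnMk_hRel {A : Finset (Fin n)} {i j : Fin n} (hi : i ∈ A) (hj : j ∈ A) :
    GnMk k n (hRel k n A i j) = 0 := by
  have := RingQuot.mkAlgHom_rel k (GnRel.rel (k := k) A i j hi hj)
  rwa [map_zero] at this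

theorem GnMk_surjective : Function.Surjective (GnMk k n) := RingQuot.mkAlgHom_surjective k _

theorem mul_gnGen_eq_zero {C : Finset (Fin n)} {x : GnOp k n}
    (hx : x ∈ diffIdeal (gnGen k n) (C.card - 1) C) : x * gnGen k n C = 0 := by
  rcases C.eq_empty_or_nonempty with rfl | hC
  · rw [gnGen_empty, mul_zero]
  induction hx using Submodule.span_induction with
  | mem x h =>
    obtain ⟨D, D', hD, hD', h1, h2, rfl⟩ := h
    have key : ∀ D ⊆ C, D.card = C.card - 1 → ∃ i ∈ C, D = C.erase i := by
      intro D hD h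
      have hpos := hC.card_pos
      have h3 : (C \ D).card = 1 := by rw [Finset.card_sdiff_of_subset hD]; omega
      obtain ⟨i, hi⟩ := Finset.card_eq_one.1 h3
      have hiC : i ∈ C \ D := by rw [hi]; exact Finset.mem_singleton_self i
      refine ⟨i, (Finset.mem_sdiff.1 hiC).1, ?_⟩
      rw [← Finset.sdiff_singleton_eq_erase, ← hi, Finset.sdiff_sdiff_eq_self hD]
    obtain ⟨i, hi, rfl⟩ := key D hD h1
    obtain ⟨j, hj, rfl⟩ := key D' hD' h2
    have := GnMk_hRel k n hi hj
    rw [hRel, map_mul, map_sub] at this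
    rw [gnGen, gnGen, gnGen, ← op_sub, ← op_mul, this, op_zero]
  | zero => exact zero_mul _
  | add x y _ _ hx hy => rw [add_mul, hx, hy, add_zero]
  | smul a x _ hx => rw [smul_eq_mul, mul_assoc, hx, mul_zero]

theorem rGen_coe (D : SubsetIdx n) : rGen k n D.1 = FreeAlgebra.ι k D := by
  simp [rGen, D.2]

/-- The quotient `gn / (r_{C∖i} - r_{C∖j})`, isomorphic to `r_C gn`. -/
abbrev GnQuot (C : SubsetIdx n) : Type :=
  GnOp k n ⧸ diffIdeal (gnGen k n) (C.1.card - 1) C.1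

/-- The class of `1` in `GnQuot`. -/
def gnQuotOne (C : SubsetIdx n) : GnQuot k n C := Submodule.Quotient.mk 1

theorem smul_gnQuotOne_eq_zero {C : SubsetIdx n} {x : GnOp k n} :
    x • gnQuotOne k n C = 0 ↔ x ∈ diffIdeal (gnGen k n) (C.1.card - 1) C.1 := by
  rw [gnQuotOne, ← Submodule.Quotient.mk_smul, smul_eq_mul, mul_one, Submodule.Quotient.mk_eq_zero]

/-- The right action of `gn` on the module `k ⊕ ∏_C gn / (r_{C∖i} - r_{C∖j})`, which is
isomorphic to `gn` itself. -/
def gnModelHom : Gn k n →ₐ[k] (Module.End k (k × ∀ C, GnQuot k n C))ᵐᵒᵖ :=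
  RingQuot.liftAlgHom k ⟨cyclicModelHom (GnMk k n) (gnQuotOne k n), by
    rintro _ _ ⟨A, i, j, hi, hj⟩
    rw [map_zero]
    have h2 := GnMk_hRel k n hi hj
    rw [hRel, rGen_coe k n ⟨A, ⟨i, hi⟩⟩] at h2 ⊢
    refine cyclicModelHom_ι_mul_eq_zero _ _ ?_ h2
    rw [smul_gnQuotOne_eq_zero, map_sub, op_sub]
    exact sub_mem_diffIdeal (Finset.erase_subset _ _) (Finset.erase_subset _ _)
      (Finset.card_erase_of_mem hi) (Finset.card_erase_of_mem hj)⟩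

theorem gnModelHom_GnMk (x : FreeA k n) :
    gnModelHom k n (GnMk k n x) = cyclicModelHom (GnMk k n) (gnQuotOne k n) x :=
  RingQuot.liftAlgHom_mkAlgHom_apply _ _ _ _

theorem isGnFamily_gnGen : IsGnFamily (gnGen k n) where
  mul_eq_zero C _ x hx := mul_gnGen_eq_zero k n hx
  mem_of_sum_eq_zero u hu C hC := by
    refine (smul_gnQuotOne_eq_zero k n (C := ⟨C, hC⟩)).1 ?_
    refine smul_eq_zero_of_sum_mul_eq_zero (GnMk k n) (gnQuotOne k n) (GnMk_surjective k n)
      (gnModelHom k n) (gnModelHom_GnMk k n) (fun D => u D.1) ?_ ⟨C, hC⟩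
    rw [← hu]
    refine Fintype.sum_of_injective Subtype.val Subtype.val_injective _ _ (fun D hD => ?_)
      fun D => by rw [← rGen_coe, gnGen]
    have hD' : D = ∅ := by
      by_contra hne
      exact hD ⟨⟨D, Finset.nonempty_iff_ne_empty.2 hne⟩, rfl⟩
    rw [hD', gnGen_empty, mul_zero]

end Gn

/-! ### The complex in terms of functions of finite sets -/

section Complex

variable {k : Type} [Field k] {n t : ℕ}

theorem eraseMin_eq {A : Finset (Fin n)} (hA : A.Nonempty) :
    eraseMin A = A.erase (A.min' hA) := dif_pos hA

/-- The index of the symbol `S(A:B)`. -/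
def KIdx.mk (A B : Finset (Fin n)) (h : A.Nonempty ∧ B ⊆ eraseMin A ∧ B.card = t) : KIdx n t :=
  ⟨(A, B), h⟩

theorem KIdx.mk_inj {A B : Finset (Fin n)} {h : A.Nonempty ∧ B ⊆ eraseMin A ∧ B.card = t}
    {A' B' : Finset (Fin n)} {h' : A'.Nonempty ∧ B' ⊆ eraseMin A' ∧ B'.card = t} :
    KIdx.mk A B h = KIdx.mk A' B' h' ↔ A = A' ∧ B = B' :=
  Subtype.ext_iff.trans Prod.mk_inj

theorem KIdx.exists_eq_mk (p : KIdx n t) : ∃ A B h, p = KIdx.mk A B h :=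
  ⟨p.1.1, p.1.2, p.2, rfl⟩

open Classical in
/-- The coefficient of `S(A:B)` in `z`, as a function of `B`, extended by zero. -/
def kCoeff (z : KMod k n t) (A B : Finset (Fin n)) : GnOp k n :=
  if h : A.Nonempty ∧ B ⊆ eraseMin A ∧ B.card = t then z (KIdx.mk A B h) else 0

theorem kCoeff_of_mem (z : KMod k n t) {A B : Finset (Fin n)}
    (h : A.Nonempty ∧ B ⊆ eraseMin A ∧ B.card = t) : kCoeff z A B = z (KIdx.mk A B h) :=
  dif_pos h

theorem kCoeff_support (z : KMod k n t) {A B : Finset (Fin n)} (h : kCoeff z A B ≠ 0) :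
    A.Nonempty ∧ B ⊆ eraseMin A ∧ B.card = t := by
  by_contra hcon
  exact h (dif_neg hcon)

theorem kCoeff_support' (z : KMod k n t) {A : Finset (Fin n)} (hA : A.Nonempty)
    (B : Finset (Fin n)) (h : kCoeff z A B ≠ 0) : B ⊆ A.erase (A.min' hA) ∧ B.card = t := by
  rw [← eraseMin_eq hA]
  exact (kCoeff_support z h).2

theorem kCoeff_zero (A B : Finset (Fin n)) : kCoeff (0 : KMod k n t) A B = 0 := by
  by_cases h : A.Nonempty ∧ B ⊆ eraseMin A ∧ B.card = t
  · rw [kCoeff_of_mem _ h, Finsupp.zero_apply]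
  · exact dif_neg h

theorem kCoeff_add (z w : KMod k n t) (A B : Finset (Fin n)) :
    kCoeff (z + w) A B = kCoeff z A B + kCoeff w A B := by
  by_cases h : A.Nonempty ∧ B ⊆ eraseMin A ∧ B.card = t
  · simp only [kCoeff_of_mem _ h, Finsupp.add_apply]
  · simp only [kCoeff, dif_neg h, add_zero]

open Classical in
theorem kCoeff_single {A B : Finset (Fin n)} (h : A.Nonempty ∧ B ⊆ eraseMin A ∧ B.card = t)
    (r : GnOp k n) (A' B' : Finset (Fin n)) :
    kCoeff (Finsupp.single (KIdx.mk A B h) r) A' B' = if A = A' ∧ B = B' then r else 0 := by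
  by_cases h' : A'.Nonempty ∧ B' ⊆ eraseMin A' ∧ B'.card = t
  · rw [kCoeff_of_mem _ h', Finsupp.single_apply]
    exact if_congr KIdx.mk_inj rfl rfl
  · rw [kCoeff, dif_neg h', if_neg]
    rintro ⟨rfl, rfl⟩
    exact h' h

theorem kMod_ext {z w : KMod k n t} (h : ∀ A, A.Nonempty → ∀ B, kCoeff z A B = kCoeff w A B) :
    z = w := by
  ext p
  obtain ⟨A, B, hp, rfl⟩ := p.exists_eq_mk
  rw [← kCoeff_of_mem z, h _ hp.1, kCoeff_of_mem]

theorem dTarget_mk {A P : Finset (Fin n)} (hp : A.Nonempty ∧ P ⊆ eraseMin A ∧ P.card = t + 1) :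
    dTarget k n t (KIdx.mk A P hp) = ∑ b ∈ P.attach, koszulSign b.1 P • Finsupp.single
      (KIdx.mk A (P.erase b.1) ⟨hp.1, (Finset.erase_subset _ _).trans hp.2.1, by
        rw [Finset.card_erase_of_mem b.2, hp.2.2]; rfl⟩)
      (gnGen k n (A \ P) - gnGen k n (eraseMin A \ P.erase b.1)) :=
  rfl

theorem zsmul_finsupp_apply {ι M : Type*} [AddCommGroup M] (c : ℤ) (f : ι →₀ M) (i : ι) :
    (c • f) i = c • f i :=
  rfl

open Classical in
theorem dTarget_apply {A P : Finset (Fin n)} (hp : A.Nonempty ∧ P ⊆ eraseMin A ∧ P.card = t + 1)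
    {A' B : Finset (Fin n)} (hq : A'.Nonempty ∧ B ⊆ eraseMin A' ∧ B.card = t) :
    dTarget k n t (KIdx.mk A P hp) (KIdx.mk A' B hq) =
      ∑ b ∈ Bᶜ, if A = A' ∧ P = insert b B then
        koszulSign b B • (gnGen k n (A' \ insert b B) - gnGen k n (eraseMin A' \ B)) else 0 := by
  have h1 : ∀ b : Fin n, (b ∈ P ∧ A = A' ∧ P.erase b = B) ↔
      (b ∈ Bᶜ ∧ A = A' ∧ P = insert b B) := by
    intro b
    rw [Finset.mem_compl]
    constructor
    · rintro ⟨hb, rfl, rfl⟩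
      exact ⟨Finset.notMem_erase _ _, rfl, (Finset.insert_erase hb).symm⟩
    · rintro ⟨hb, rfl, rfl⟩
      exact ⟨Finset.mem_insert_self _ _, rfl, Finset.erase_insert hb⟩
  have h2 : dTarget k n t (KIdx.mk A P hp) (KIdx.mk A' B hq) =
      ∑ b ∈ P, if A = A' ∧ P.erase b = B then
        koszulSign b P • (gnGen k n (A \ P) - gnGen k n (eraseMin A \ P.erase b)) else 0 := by
    rw [dTarget_mk, Finsupp.finsetSum_apply, ← Finset.sum_attach P]
    refine Finset.sum_congr rfl fun b _ => ?_
    refine (zsmul_finsupp_apply _ _ _).trans ?_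
    rw [Finsupp.single_apply]
    refine (congrArg _ (if_congr KIdx.mk_inj rfl rfl)).trans ?_
    split_ifs
    · rfl
    · exact zsmul_zero _
  rw [h2, ← Finset.sum_filter, ← Finset.sum_filter]
  have h3 : P.filter (fun b => A = A' ∧ P.erase b = B) =
      Bᶜ.filter (fun b => A = A' ∧ P = insert b B) := by
    ext b
    rw [Finset.mem_filter, Finset.mem_filter, h1]
  rw [h3]
  refine Finset.sum_congr rfl fun b hb => ?_
  rw [Finset.mem_filter, Finset.mem_compl] at hb
  obtain ⟨hb, rfl, rfl⟩ := hb
  rw [koszulSign_insert_self, Finset.erase_insert hb]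

theorem dMap_apply (z : KMod k n (t + 1)) {A B : Finset (Fin n)}
    (hq : A.Nonempty ∧ B ⊆ eraseMin A ∧ B.card = t) :
    dMap k n t z (KIdx.mk A B hq) =
      koszulDel (gnGen k n) A (A.min' hq.1) (kCoeff z A) B := by
  classical
  induction z using Finsupp.induction_linear with
  | zero =>
    rw [map_zero, Finsupp.zero_apply, koszulDel_eq_zero_of_forall fun _ _ => kCoeff_zero _ _]
  | add z w hz hw =>
    rw [map_add, Finsupp.add_apply, hz, hw, ← koszulDel_add]
    simp only [← kCoeff_add]
  | single p r =>
    obtain ⟨A', P, hp, rfl⟩ := p.exists_eq_mk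
    have h : dMap k n t (Finsupp.single (KIdx.mk A' P hp) r) =
        r • dTarget k n t (KIdx.mk A' P hp) := by
      rw [dMap, Finsupp.lsum_single, LinearMap.toSpanSingleton_apply]
    rw [h, Finsupp.smul_apply, dTarget_apply, koszulDel_eq_sum_mul, ← eraseMin_eq, smul_eq_mul,
      Finset.mul_sum]
    refine Finset.sum_congr rfl fun b _ => ?_
    rw [kCoeff_single, mul_ite, ite_mul, mul_zero, zero_mul]

theorem kCoeff_dMap (z : KMod k n (t + 1)) {A : Finset (Fin n)} (hA : A.Nonempty)
    (B : Finset (Fin n)) :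
    kCoeff (dMap k n t z) A B = koszulDel (gnGen k n) A (A.min' hA) (kCoeff z A) B := by
  by_cases h : A.Nonempty ∧ B ⊆ eraseMin A ∧ B.card = t
  · rw [kCoeff_of_mem _ h, dMap_apply]
  · rw [kCoeff, dif_neg h, koszulDel_eq_zero_of_forall fun b hb => ?_]
    by_contra h0
    obtain ⟨h1, h2, h3⟩ := kCoeff_support z h0
    rw [Finset.card_insert_of_notMem hb] at h3
    exact h ⟨h1, (Finset.subset_insert _ _).trans h2, by omega⟩

theorem dZero_single {A : Finset (Fin n)}
    (h : A.Nonempty ∧ ∅ ⊆ eraseMin A ∧ (∅ : Finset _).card = 0)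
    (r : GnOp k n) :
    (dZero k n (Finsupp.single (KIdx.mk A ∅ h) r) : GnOp k n) = r * gnGen k n A := by
  rw [dZero, Finsupp.lsum_single, LinearMap.toSpanSingleton_apply]
  rfl

theorem coe_dZero (z : KMod k n 0) :
    (dZero k n z : GnOp k n) = ∑ A, kCoeff z A ∅ * gnGen k n A := by
  classical
  induction z using Finsupp.induction_linear with
  | zero => simp only [map_zero, kCoeff_zero, zero_mul, Finset.sum_const_zero]; rfl
  | add z w hz hw =>
    rw [map_add, Submodule.coe_add, hz, hw, ← Finset.sum_add_distrib]
    simp only [kCoeff_add, add_mul]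
  | single p r =>
    obtain ⟨A, P, h, rfl⟩ := p.exists_eq_mk
    obtain rfl := Finset.card_eq_zero.1 h.2.2
    rw [dZero_single, Finset.sum_eq_single A]
    · rw [kCoeff_single, if_pos ⟨rfl, rfl⟩]
    · intro A' _ hne
      rw [kCoeff_single, if_neg (fun e => hne e.1.symm), zero_mul]
    · exact fun h => absurd (Finset.mem_univ _) h

instance (n t : ℕ) : Finite (KIdx n t) :=
  inferInstanceAs (Finite {p : Finset (Fin n) × Finset (Fin n) //
    p.1.Nonempty ∧ p.2 ⊆ eraseMin p.1 ∧ p.2.card = t})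

theorem exists_kCoeff_eq (y : ∀ A : Finset (Fin n), A.Nonempty → Finset (Fin n) → GnOp k n)
    (hy : ∀ A hA D, y A hA D ≠ 0 → D ⊆ A.erase (A.min' hA) ∧ D.card = t) :
    ∃ w : KMod k n t, ∀ A hA, kCoeff w A = y A hA := by
  refine ⟨Finsupp.equivFunOnFinite.symm fun p => y p.1.1 p.2.1 p.1.2,
    fun A hA => funext fun D => ?_⟩
  by_cases h : A.Nonempty ∧ D ⊆ eraseMin A ∧ D.card = t
  · rw [kCoeff_of_mem _ h]
    rfl
  · rw [kCoeff, dif_neg h]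
    by_contra h0
    have := hy A hA D (Ne.symm h0)
    rw [← eraseMin_eq hA] at this
    exact h ⟨hA, this⟩

theorem mem_range_dMap {z : KMod k n t}
    (hz : ∀ A (hA : A.Nonempty), ∃ y : Finset (Fin n) → GnOp k n,
      (∀ D, y D ≠ 0 → D ⊆ A.erase (A.min' hA) ∧ D.card = t + 1) ∧
      ∀ B, koszulDel (gnGen k n) A (A.min' hA) y B = kCoeff z A B) :
    z ∈ LinearMap.range (dMap k n t) := by
  choose y hy hyz using hz
  obtain ⟨w, hw⟩ := exists_kCoeff_eq y hy
  exact ⟨w, kMod_ext fun A hA B => by rw [kCoeff_dMap w hA, hw A hA, hyz]⟩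

theorem ker_dMap_eq_range (k : Type) [Field k] (n t : ℕ) :
    LinearMap.ker (dMap k n t) = LinearMap.range (dMap k n (t + 1)) := by
  refine le_antisymm (fun z hz => mem_range_dMap fun A hA => ?_) ?_
  · by_cases h0 : ∀ B, kCoeff z A B = 0
    · refine ⟨fun _ => 0, fun D h => absurd rfl h, fun B => ?_⟩
      rw [h0, koszulDel_eq_zero_of_forall fun _ _ => rfl]
    · obtain ⟨B, hB⟩ := not_forall.1 h0
      obtain ⟨h1, h2⟩ := kCoeff_support' z hA B hB
      have h3 := Finset.card_le_card h1
      rw [Finset.card_erase_of_mem (A.min'_mem hA)] at h3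
      obtain ⟨m, hm⟩ : ∃ m, A.card = t + 1 + m + 1 := ⟨A.card - (t + 2), by
        have := hA.card_pos
        omega⟩
      obtain ⟨h4, h5⟩ := (isGnFamily_gnGen k n).mem_diffIdeal_of_koszulDel_eq_zero
        (A.min'_mem hA) hm (kCoeff_support' z hA) (fun B _ _ => by
          rw [← kCoeff_dMap, LinearMap.mem_ker.1 hz, kCoeff_zero])
      exact (isGnFamily_gnGen k n).exists_koszulDel_eq (A.min'_mem hA) hm
        (kCoeff_support' z hA) h4 h5
  · rintro _ ⟨y, rfl⟩
    refine LinearMap.mem_ker.2 (kMod_ext fun A hA B => ?_)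
    rw [kCoeff_zero, kCoeff_dMap _ hA]
    have hdy : kCoeff (dMap k n (t + 1) y) A = koszulDel (gnGen k n) A (A.min' hA) (kCoeff y A) :=
      funext fun B => kCoeff_dMap y hA B
    by_cases hm : ∃ m, A.card = t + 1 + m + 1
    · obtain ⟨m, hm⟩ := hm
      refine (isGnFamily_gnGen k n).koszulDel_eq_zero (A.min'_mem hA) hm (kCoeff_support' _ hA)
        ?_ ?_ B
      · rw [hdy]
        exact koszulDel_mem_diffIdeal (A.min'_mem hA) hm (kCoeff_support' y hA)
      · rw [hdy]
        exact simplicialDel_koszulDel_mem_diffIdeal (A.min'_mem hA) hm (kCoeff_support' y hA)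
    · refine koszulDel_eq_zero_of_forall fun b _ => ?_
      by_contra h0
      obtain ⟨h1, h2⟩ := kCoeff_support' _ hA _ h0
      have h3 := Finset.card_le_card h1
      rw [Finset.card_erase_of_mem (A.min'_mem hA)] at h3
      have := hA.card_pos
      exact hm ⟨A.card - (t + 2), by omega⟩

theorem ker_dZero_eq_range (k : Type) [Field k] (n : ℕ) :
    LinearMap.ker (dZero k n) = LinearMap.range (dMap k n 0) := by
  have hcard : ∀ A : Finset (Fin n), A.Nonempty → A.card = 0 + (A.card - 1) + 1 := fun A hA => by
    have := hA.card_pos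
    omega
  refine le_antisymm (fun z hz => mem_range_dMap fun A hA => ?_) ?_
  · have h1 : ∑ A, kCoeff z A ∅ * gnGen k n A = 0 := by
      rw [← coe_dZero, LinearMap.mem_ker.1 hz]
      rfl
    have h2 := (isGnFamily_gnGen k n).mem_of_sum_eq_zero _ h1 A hA
    refine (isGnFamily_gnGen k n).exists_koszulDel_eq (A.min'_mem hA) (hcard A hA)
      (kCoeff_support' z hA) (fun D => ?_) fun D => ?_
    · by_cases h0 : kCoeff z A D = 0
      · rw [h0]; exact Submodule.zero_mem _
      · obtain rfl := Finset.card_eq_zero.1 (kCoeff_support z h0).2.2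
        rwa [Finset.sdiff_empty]
    · have h3 : simplicialDel (kCoeff z A) D = 0 := by
        refine simplicialDel_eq_zero_of_forall fun b _ => ?_
        by_contra h0
        exact Finset.insert_ne_empty _ _ (Finset.card_eq_zero.1 (kCoeff_support z h0).2.2)
      rw [h3]
      exact Submodule.zero_mem _
  · rintro _ ⟨y, rfl⟩
    refine LinearMap.mem_ker.2 (Subtype.ext ?_)
    rw [coe_dZero]
    refine Finset.sum_eq_zero fun A _ => ?_
    rcases A.eq_empty_or_nonempty with rfl | hA
    · rw [gnGen_empty, mul_zero]
    · refine mul_gnGen_eq_zero k n ?_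
      have := koszulDel_mem_diffIdeal (ρ := gnGen k n) (A.min'_mem hA) (hcard A hA)
        (kCoeff_support' y hA) ∅
      rwa [Finset.sdiff_empty, ← kCoeff_dMap] at this

theorem mul_gnGen_mem_range (r : GnOp k n) (A : SubsetIdx n) :
    r * gnGen k n A.1 ∈ LinearMap.range ((augIdealG k n).subtype ∘ₗ dZero k n) := by
  exact ⟨Finsupp.single (KIdx.mk A.1 ∅ ⟨A.2, Finset.empty_subset _, rfl⟩) r, dZero_single _ r⟩

theorem dZero_surjective (k : Type) [Field k] (n : ℕ) : Function.Surjective (dZero k n) := by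
  have h : augIdealG k n ≤ LinearMap.range ((augIdealG k n).subtype ∘ₗ dZero k n) := by
    refine Ideal.span_le.2 ?_
    rintro _ ⟨d, hd, _, ⟨x, hx, rfl⟩, rfl⟩
    change op (GnMk k n x) ∈ LinearMap.range ((augIdealG k n).subtype ∘ₗ dZero k n)
    induction hx using Submodule.span_induction with
    | mem x h =>
      obtain ⟨l, hl, rfl⟩ := h
      rcases l with - | ⟨A, l⟩
      · simp only [List.length_nil] at hl
        omega
      · rw [List.map_cons, List.prod_cons, map_mul, op_mul, ← rGen_coe]
        exact mul_gnGen_mem_range _ A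
    | zero => rw [map_zero, op_zero]; exact Submodule.zero_mem _
    | add x y _ _ hx hy => rw [map_add, op_add]; exact Submodule.add_mem _ hx hy
    | smul c x _ hx =>
      rw [map_smul, op_smul]
      exact Submodule.smul_of_tower_mem _ c hx
  intro x
  obtain ⟨z, hz⟩ := h x.2
  exact ⟨z, Subtype.ext hz⟩

end Complex

/-- the complex `K^n` is exact at every position.  (For `t + 1 > n` the
index type `KIdx n (t+1)` is empty and `K^n_{t+2}` is the zero module, so this expresses
the exactness of the finite complex `0 → K^n_n → ⋯ → K^n_1 → K^n_0 → 0`.) -/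
theorem Koszul_complex_exact (k : Type) [Field k] (n : ℕ) (hn : 2 ≤ n) :
    Function.Surjective (dZero k n) ∧
    LinearMap.ker (dZero k n) = LinearMap.range (dMap k n 0) ∧
    ∀ t : ℕ, LinearMap.ker (dMap k n t) = LinearMap.range (dMap k n (t + 1)) := by
  exact ⟨dZero_surjective k n, ker_dZero_eq_range k n, ker_dMap_eq_range k n⟩
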